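/- arXiv:1504.02596 — 3 statements merged into one kernel-verified Lean document; each statement's English description precedes it below -/
import Mathlib

section
/- Let f : ℝ → ℝ be continuous with f(x+1) - f(x) = l for all x, l a nonzero integer, with bounded variation on [0,1], and α irrational; define T(x,y) = (x+α, f(x)+y) on 𝕋². Then for all sufficiently small ε > 0 there exist constants c₁(ε), c₂(ε) > 0 such that c₁(ε)n ≤ r(n,ε) ≤ c₂(ε)n for all n ≥ 1, and c₁(ε) → ∞ as ε → 0, where r(n,ε) is the minimal cardinality of an (n,ε)-spanning set of (𝕋², T). -/
open Set Filter

abbrev Torus1 := AddCircle (1:ℝ)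
abbrev Torus2 := Torus1 × Torus1

/-- `Fset` is an `(n, ε)`-spanning set for `T`: every point of the torus is within
Bowen `d_n`-distance `ε` of a point of `Fset`. -/
def IsSpanningSet (T : Torus2 → Torus2) (n : ℕ) (ε : ℝ) (Fset : Finset Torus2) : Prop :=
  ∀ p : Torus2, ∃ q ∈ Fset, ∀ i < n, dist (T^[i] p) (T^[i] q) ≤ ε

/-- `r(n, ε)`: the minimal cardinality of an `(n, ε)`-spanning set. -/
noncomputable def spanNum (T : Torus2 → Torus2) (n : ℕ) (ε : ℝ) : ℕ :=
  sInf {k : ℕ | ∃ Fset : Finset Torus2, IsSpanningSet T n ε Fset ∧ Fset.card = k}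

namespace Stmt3Aux

/-- Birkhoff sums. -/
noncomputable def bsum (f : ℝ → ℝ) (α : ℝ) (i : ℕ) (x : ℝ) : ℝ :=
  ∑ j ∈ Finset.range i, f (x + j * α)

lemma coe_fract_aux (r : ℝ) : ((Int.fract r : ℝ) : Torus1) = r := by
  have h : ((⌊r⌋ : ℝ) : Torus1) = 0 := by
    rw [AddCircle.coe_eq_zero_iff]; exact ⟨⌊r⌋, by simp⟩
  conv_rhs => rw [← Int.fract_add_floor r, AddCircle.coe_add, h, add_zero]

lemma iter_formula (α : ℝ) (f : ℝ → ℝ) (F : Torus1 → Torus1)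
    (hF : ∀ x : ℝ, F (x : Torus1) = ((f x : ℝ) : Torus1))
    (T : Torus2 → Torus2)
    (hT : ∀ p : Torus2, T p = (p.1 + (α : Torus1), F p.1 + p.2)) (x y : ℝ) (i : ℕ) :
    T^[i] ((x : Torus1), (y : Torus1)) =
      (((x + i * α : ℝ) : Torus1), ((y + bsum f α i x : ℝ) : Torus1)) := by
  induction i with
  | zero => simp [bsum]
  | succ k ih =>
    rw [Function.iterate_succ_apply', ih, hT]
    ext
    · simp only
      rw [← AddCircle.coe_add]
      congr 1
      push_cast
      ring
    · simp only
      rw [hF, ← AddCircle.coe_add]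
      congr 1
      simp only [bsum, Finset.sum_range_succ]
      ring

lemma f_int (l : ℤ) (f : ℝ → ℝ) (hfl : ∀ x : ℝ, f (x + 1) - f x = l) (x : ℝ) (m : ℤ) :
    f (x + m) = f x + m * l := by
  have hN : ∀ (k : ℕ) (x : ℝ), f (x + k) = f x + k * l := by
    intro k
    induction k with
    | zero => intro x; simp
    | succ k ih =>
      intro x
      have h1 := hfl (x + k)
      have h2 := ih x
      push_cast
      rw [← add_assoc]
      linarith
  obtain ⟨k, rfl | rfl⟩ := m.eq_nat_or_neg
  · exact_mod_cast hN k x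
  · have := hN k (x + ((-(k:ℤ) : ℤ) : ℝ))
    push_cast at this ⊢
    rw [neg_add_cancel_right] at this
    linarith

lemma unif (l : ℤ) (f : ℝ → ℝ) (hf : Continuous f) (hfl : ∀ x : ℝ, f (x + 1) - f x = l) :
    ∃ δ > 0, ∀ x y : ℝ, |x - y| ≤ δ → |f x - f y| ≤ 1 / 4 := by
  have hu := (isCompact_Icc (a := (-1:ℝ)) (b := 2)).uniformContinuousOn_of_continuous
    hf.continuousOn
  rw [Metric.uniformContinuousOn_iff] at hu
  obtain ⟨δ, hδ, h⟩ := hu (1/4) (by norm_num)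
  refine ⟨min (δ/2) 1, by positivity, fun x y hxy => ?_⟩
  have h1 := hxy.trans (min_le_left _ _)
  have h2 := hxy.trans (min_le_right _ _)
  have hx0 := Int.floor_le x
  have hx1 := Int.lt_floor_add_one x
  rw [abs_le] at h2
  have h3 := h (x - ⌊x⌋) ⟨by linarith, by linarith⟩ (y - ⌊x⌋) ⟨by linarith, by linarith⟩
    (by rw [Real.dist_eq]; ring_nf; ring_nf at h1; linarith)
  rw [Real.dist_eq] at h3
  have e1 := f_int l f hfl (x - ⌊x⌋) ⌊x⌋
  have e2 := f_int l f hfl (y - ⌊x⌋) ⌊x⌋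
  rw [sub_add_cancel] at e1 e2
  rw [e1, e2, add_sub_add_right_eq_sub]
  exact h3.le

lemma exists_W (l : ℤ) (f : ℝ → ℝ) (hfl : ∀ x : ℝ, f (x + 1) - f x = l)
    (hbv : BoundedVariationOn f (Icc (0:ℝ) 1)) :
    ∃ (W : ℝ → ℝ) (C : ℝ), 0 ≤ C ∧ (∀ x, W (x + 1) = W x + C) ∧
      ∀ x y, x ≤ y → |f x - f y| ≤ W y - W x := by
  obtain ⟨p, q, hp, hq, hpq⟩ := hbv.locallyBoundedVariationOn.exists_monotoneOn_sub_monotoneOn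
  set V : ℝ → ℝ := fun t => p t + q t - p 0 - q 0 with hV
  have hVf : ∀ s t, 0 ≤ s → s ≤ t → t ≤ 1 → |f s - f t| ≤ V t - V s := by
    intro s t hs hst ht
    have a1 := hp ⟨hs, hst.trans ht⟩ ⟨hs.trans hst, ht⟩ hst
    have a2 := hq ⟨hs, hst.trans ht⟩ ⟨hs.trans hst, ht⟩ hst
    have b : f = fun t => p t - q t := hpq
    rw [b, abs_le]
    simp only [hV]
    constructor <;> linarith
  have hV0 : V 0 = 0 := by simp [hV]
  have hl1 : |(l:ℝ)| ≤ V 1 := by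
    have := hVf 0 1 le_rfl zero_le_one le_rfl
    have h2 := hfl 0
    rw [zero_add] at h2
    rw [← h2, abs_sub_comm]
    linarith
  refine ⟨fun x => ⌊x⌋ * V 1 + V (Int.fract x), V 1, (abs_nonneg _).trans hl1, ?_, ?_⟩
  · intro x
    simp only [Int.floor_add_one, Int.fract_add_one]
    push_cast
    ring
  · intro x y hxy
    have fx0 := Int.fract_nonneg x
    have fx1 := (Int.fract_lt_one x).le
    have fy0 := Int.fract_nonneg y
    have fy1 := (Int.fract_lt_one y).le
    have ex : f x = f (Int.fract x) + ⌊x⌋ * l := by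
      rw [← f_int l f hfl, Int.fract_add_floor]
    have ey : f y = f (Int.fract y) + ⌊y⌋ * l := by
      rw [← f_int l f hfl, Int.fract_add_floor]
    simp only
    rcases (Int.floor_le_floor hxy).eq_or_lt with h | h
    · have hfr : Int.fract x ≤ Int.fract y := by
        unfold Int.fract
        rw [h]; linarith
      have := hVf _ _ fx0 hfr fy1
      rw [ex, ey, h, add_sub_add_right_eq_sub]
      linarith
    · have h' : (0:ℝ) ≤ (⌊y⌋:ℝ) - ⌊x⌋ - 1 := by
        have : ⌊x⌋ + 1 ≤ ⌊y⌋ := h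
        have : ((⌊x⌋ + 1 : ℤ) : ℝ) ≤ ⌊y⌋ := by exact_mod_cast this
        push_cast at this
        linarith
      have a1 := hVf _ _ fx0 fx1 le_rfl
      have a2 := hVf _ _ le_rfl fy0 fy1
      have a3 : |((⌊y⌋:ℝ) - ⌊x⌋ - 1) * l| ≤ ((⌊y⌋:ℝ) - ⌊x⌋ - 1) * V 1 := by
        rw [abs_mul, abs_of_nonneg h']
        gcongr
      have h2 := hfl 0
      rw [zero_add] at h2
      rw [abs_le] at *
      rw [ex, ey]
      constructor <;> nlinarith

lemma upper (l : ℤ) (α : ℝ)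
    (f : ℝ → ℝ) (hfl : ∀ x : ℝ, f (x + 1) - f x = l)
    (hbv : BoundedVariationOn f (Icc (0:ℝ) 1))
    (F : Torus1 → Torus1) (hF : ∀ x : ℝ, F (x : Torus1) = ((f x : ℝ) : Torus1))
    (T : Torus2 → Torus2)
    (hT : ∀ p : Torus2, T p = (p.1 + (α : Torus1), F p.1 + p.2)) :
    ∃ C : ℝ, 0 ≤ C ∧ ∀ ε > 0, ∀ n : ℕ, 1 ≤ n → ∃ Fs : Finset Torus2, IsSpanningSet T n ε Fs ∧
      (Fs.card : ℝ) ≤ (2 * (C + 1) / ε + 1) * (2 / ε + 1) * n := by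
  obtain ⟨W, C, hC, hW1, hWf⟩ := exists_W l f hfl hbv
  refine ⟨C, hC, fun ε hε n hn => ?_⟩
  have hWm : Monotone W := fun x y h => by
    have := (abs_nonneg _).trans (hWf x y h); linarith
  set G : ℝ → ℝ := fun x => x + (bsum W α n x - bsum W α n 0) with hG
  have bmono : ∀ i, Monotone (bsum W α i) := fun i x y h =>
    Finset.sum_le_sum fun j _ => hWm (by linarith)
  have key : ∀ x y, x ≤ y → ∀ i ≤ n, |bsum f α i x - bsum f α i y| ≤ G y - G x := by
    intro x y h i hi
    have h1 : |bsum f α i x - bsum f α i y| ≤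
        ∑ j ∈ Finset.range i, (W (y + j * α) - W (x + j * α)) := by
      unfold bsum
      rw [← Finset.sum_sub_distrib]
      refine (Finset.abs_sum_le_sum_abs _ _).trans (Finset.sum_le_sum fun j _ => ?_)
      exact hWf _ _ (by linarith)
    have h2 : ∑ j ∈ Finset.range i, (W (y + j * α) - W (x + j * α)) ≤
        ∑ j ∈ Finset.range n, (W (y + j * α) - W (x + j * α)) := by
      refine Finset.sum_le_sum_of_subset_of_nonneg (Finset.range_mono hi) fun j _ _ => ?_
      have := hWm (show x + j * α ≤ y + j * α by linarith)
      linarith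
    have h3 : ∑ j ∈ Finset.range n, (W (y + j * α) - W (x + j * α)) =
        bsum W α n y - bsum W α n x := Finset.sum_sub_distrib _ _
    simp only [hG]
    linarith
  have key2 : ∀ x y, x ≤ y → |x - y| ≤ G y - G x := by
    intro x y h
    have := bmono n h
    rw [abs_sub_comm, abs_of_nonneg (by linarith)]
    simp only [hG]; linarith
  have key' : ∀ x y, ∀ i ≤ n, |bsum f α i x - bsum f α i y| ≤ |G x - G y| := by
    intro x y i hi
    rcases le_total x y with h | h
    · rw [abs_sub_comm (G x)]; exact (key x y h i hi).trans (le_abs_self _)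
    · rw [abs_sub_comm]; exact (key y x h i hi).trans (le_abs_self _)
  have key2' : ∀ x y, |x - y| ≤ |G x - G y| := by
    intro x y
    rcases le_total x y with h | h
    · rw [abs_sub_comm (G x)]; exact (key2 x y h).trans (le_abs_self _)
    · rw [abs_sub_comm]; exact (key2 y x h).trans (le_abs_self _)
  have hG0 : ∀ x, 0 ≤ x → 0 ≤ G x := fun x hx => by
    have := bmono n hx
    simp only [hG]; linarith
  have hG1 : ∀ x, x ≤ 1 → G x ≤ 1 + n * C := fun x hx => by
    have h1 := bmono n hx
    have h2 : bsum W α n 1 = bsum W α n 0 + n * C := by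
      have : ∀ j : ℕ, W (1 + j * α) = W (0 + j * α) + C := fun j => by
        rw [← hW1]; congr 1; ring
      simp only [bsum, this, Finset.sum_add_distrib]
      simp
    simp only [hG]; linarith
  have hmeet : ∀ a b : ℝ, 0 ≤ a → 0 ≤ b → ⌊2 * a / ε⌋₊ = ⌊2 * b / ε⌋₊ → |a - b| < ε / 2 := by
    intro a b ha hb h
    have a1 := Nat.floor_le (show 0 ≤ 2 * a / ε by positivity)
    have a2 := Nat.lt_floor_add_one (2 * a / ε)
    have b1 := Nat.floor_le (show 0 ≤ 2 * b / ε by positivity)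
    have b2 := Nat.lt_floor_add_one (2 * b / ε)
    rw [h] at a1 a2
    rw [le_div_iff₀ hε] at a1 b1
    rw [div_lt_iff₀ hε] at a2 b2
    rw [abs_lt]; constructor <;> nlinarith
  -- keys
  set K : ℝ × ℝ → ℕ × ℕ := fun p => (⌊2 * G p.1 / ε⌋₊, ⌊2 * p.2 / ε⌋₊) with hK
  classical
  set D : Set (ℝ × ℝ) := Icc 0 1 ×ˢ Icc 0 1 with hD
  set R : ℕ × ℕ → ℝ × ℝ := fun k => if h : ∃ p ∈ D, K p = k then h.choose else (0, 0) with hR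
  set A : Finset (ℕ × ℕ) :=
    Finset.range (⌊2 * (1 + n * C) / ε⌋₊ + 1) ×ˢ Finset.range (⌊2 * 1 / ε⌋₊ + 1) with hA
  refine ⟨A.image fun k => (((R k).1 : Torus1), ((R k).2 : Torus1)), ?_, ?_⟩
  · rintro ⟨x, y⟩
    have lift : ∀ z : Torus1, ∃ r : ℝ, 0 ≤ r ∧ r ≤ 1 ∧ (r : Torus1) = z := by
      intro z
      induction z using QuotientAddGroup.induction_on with
      | H r =>
        refine ⟨Int.fract r, Int.fract_nonneg r, (Int.fract_lt_one r).le, ?_⟩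
        exact coe_fract_aux r
    obtain ⟨x, hx0, hx1, rfl⟩ := lift x
    obtain ⟨y, hy0, hy1, rfl⟩ := lift y
    have hex : ∃ p ∈ D, K p = K (x, y) := ⟨(x, y), ⟨⟨hx0, hx1⟩, ⟨hy0, hy1⟩⟩, rfl⟩
    have hRe : R (K (x, y)) = hex.choose := by simp only [hR]; exact dif_pos hex
    obtain ⟨hq1, hq2⟩ := hex.choose_spec
    rw [← hRe] at hq1 hq2
    refine ⟨_, Finset.mem_image_of_mem _ (a := K (x, y)) ?_, ?_⟩
    · simp only [hA, hK, Finset.mem_product, Finset.mem_range, Nat.lt_add_one_iff]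
      constructor
      · apply Nat.floor_le_floor
        have := hG1 x hx1
        gcongr
      · apply Nat.floor_le_floor
        gcongr
    · intro i hi
      clear hRe
      generalize R (K (x, y)) = q at hq1 hq2 ⊢
      obtain ⟨x', y'⟩ := q
      obtain ⟨⟨hx0', hx1'⟩, ⟨hy0', hy1'⟩⟩ := hq1
      simp only [hK, Prod.mk.injEq] at hq2
      have d1 := hmeet _ _ (hG0 _ hx0') (hG0 _ hx0) hq2.1
      have d2 := hmeet _ _ hy0' hy0 hq2.2
      have d3 := key' x' x i hi.le
      have d4 := key2' x' x
      rw [iter_formula α f F hF T hT, iter_formula α f F hF T hT, Prod.dist_eq]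
      have nle : ∀ r : ℝ, ‖(r : Torus1)‖ ≤ |r| := fun r => by
        rw [UnitAddCircle.norm_eq]
        simpa using round_le r 0
      refine max_le ?_ ?_
      · simp only
        rw [dist_eq_norm, ← AddCircle.coe_sub]
        refine (nle _).trans ?_
        rw [abs_sub_comm]
        rw [add_sub_add_right_eq_sub]
        linarith
      · simp only
        rw [dist_eq_norm, ← AddCircle.coe_sub]
        refine (nle _).trans ?_
        have := abs_add_le (y' - y) (bsum f α i x' - bsum f α i x)
        rw [abs_sub_comm, add_sub_add_comm]
        linarith
  · refine (Nat.cast_le.2 Finset.card_image_le).trans ?_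
    rw [hA, Finset.card_product, Finset.card_range, Finset.card_range]
    push_cast
    have hn' : (1:ℝ) ≤ n := by exact_mod_cast hn
    have e1 : (⌊2 * (1 + n * C) / ε⌋₊ : ℝ) ≤ 2 * (1 + n * C) / ε := Nat.floor_le (by positivity)
    have e2 : (⌊2 * 1 / ε⌋₊ : ℝ) ≤ 2 * 1 / ε := Nat.floor_le (by positivity)
    have e3 : 2 * (1 + n * C) / ε + 1 ≤ (2 * (C + 1) / ε + 1) * n := by
      have : 2 * (1 + n * C) / ε ≤ 2 * (C + 1) / ε * n := by
        rw [div_mul_eq_mul_div]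
        refine div_le_div_of_nonneg_right ?_ hε.le
        nlinarith
      nlinarith
    calc _ ≤ ((2 * (C + 1) / ε + 1) * n) * (2 / ε + 1) := by
          gcongr
          · linarith
          · simpa using e2
      _ = _ := by ring

/-- A continuous function whose image of `[0,1]` is covered by few short intervals. -/
lemma cover {ι : Type*} (s : Finset ι) (c : ι → ℝ) (g : ℝ → ℝ) (hg : Continuous g) (ρ : ℝ)
    (hρ : 0 ≤ ρ) (h : ∀ x ∈ Icc (0:ℝ) 1, ∃ i ∈ s, |g x - c i| ≤ ρ) :
    |g 1 - g 0| ≤ s.card * (2 * ρ) := by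
  have hsub : uIcc (g 0) (g 1) ⊆ ⋃ i ∈ s, Metric.closedBall (c i) ρ := by
    refine (intermediate_value_uIcc hg.continuousOn).trans ?_
    rw [uIcc_of_le zero_le_one]
    rintro _ ⟨x, hx, rfl⟩
    obtain ⟨i, hi, hd⟩ := h x hx
    simp only [mem_iUnion]
    exact ⟨i, hi, by rwa [Metric.mem_closedBall, Real.dist_eq]⟩
  have h1 := (MeasureTheory.measure_mono (μ := MeasureTheory.volume) hsub).trans
    (MeasureTheory.measure_biUnion_finset_le s _)
  simp only [uIcc, Real.volume_Icc, max_sub_min_eq_abs, Real.volume_closedBall, Finset.sum_const, nsmul_eq_mul] at h1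
  rw [← ENNReal.ofReal_natCast, ← ENNReal.ofReal_mul (by positivity),
    ENNReal.ofReal_le_ofReal_iff (by positivity)] at h1
  exact h1

lemma lower (l : ℤ) (hl : l ≠ 0) (α : ℝ)
    (f : ℝ → ℝ) (hf : Continuous f) (hfl : ∀ x : ℝ, f (x + 1) - f x = l)
    (F : Torus1 → Torus1) (hF : ∀ x : ℝ, F (x : Torus1) = ((f x : ℝ) : Torus1))
    (T : Torus2 → Torus2)
    (hT : ∀ p : Torus2, T p = (p.1 + (α : Torus1), F p.1 + p.2))
    (δ : ℝ) (hδ : ∀ x y : ℝ, |x - y| ≤ δ → |f x - f y| ≤ 1 / 4)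
    (ε : ℝ) (hε : 0 < ε) (hε1 : ε ≤ δ) (hε2 : ε ≤ 1 / 4) (n : ℕ) (hn : 1 ≤ n)
    (Fs : Finset Torus2) (hFs : IsSpanningSet T n ε Fs) :
    1 / (24 * ε) * n ≤ Fs.card := by
  -- real representatives
  have lift : ∀ z : Torus1, ∃ r : ℝ, 0 ≤ r ∧ r < 1 ∧ (r : Torus1) = z := by
    intro z
    induction z using QuotientAddGroup.induction_on with
    | H r =>
      refine ⟨Int.fract r, Int.fract_nonneg r, Int.fract_lt_one r, ?_⟩
      exact coe_fract_aux r
  choose ρ hρ0 hρ1 hρ using lift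
  set M : Finset ℤ := {-1, 0, 1} with hM
  have main : ∀ x ∈ Icc (0:ℝ) 1, ∃ k ∈ Fs ×ˢ M,
      |x - (ρ k.1.1 + k.2)| ≤ ε ∧
      ∀ i < n, |bsum f α i x - bsum f α i (ρ k.1.1 + k.2)| ≤ 2 * ε := by
    intro x hx
    obtain ⟨⟨a, b⟩, hq, hd⟩ := hFs ((x : Torus1), ((0:ℝ) : Torus1))
    have h0 := hd 0 (by omega)
    simp only [Function.iterate_zero, id, Prod.dist_eq] at h0
    have h0a := (le_max_left _ _).trans h0
    have h0b := (le_max_right _ _).trans h0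
    rw [← hρ a, dist_eq_norm, ← AddCircle.coe_sub, UnitAddCircle.norm_eq] at h0a
    rw [← hρ b, dist_eq_norm, ← AddCircle.coe_sub, UnitAddCircle.norm_eq] at h0b
    set m := round (x - ρ a) with hm
    set m' := round (0 - ρ b) with hm'
    have r0 := hρ0 a
    have r1 := hρ1 a
    have hmM : m ∈ M := by
      have h1 := abs_le.1 h0a
      have u1 : (m:ℝ) < 2 := by linarith [hx.2]
      have u2 : (-2:ℝ) < m := by linarith [hx.1]
      have v1 : m < 2 := by exact_mod_cast u1
      have v2 : -2 < m := by exact_mod_cast u2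
      simp only [hM, Finset.mem_insert, Finset.mem_singleton]
      omega
    have hxa : |x - (ρ a + m)| ≤ ε := by rwa [← sub_sub]
    refine ⟨((a, b), m), Finset.mk_mem_product hq hmM, hxa, ?_⟩
    set z := ρ a + m with hz
    have hza : (z : Torus1) = a := by
      rw [hz, AddCircle.coe_add, hρ]
      have : ((m : ℝ) : Torus1) = 0 := by
        rw [AddCircle.coe_eq_zero_iff]; exact ⟨m, by simp⟩
      rw [this, add_zero]
    set w := ρ b + m' with hw
    have hwb : (w : Torus1) = b := by
      rw [hw, AddCircle.coe_add, hρ]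
      have : ((m' : ℝ) : Torus1) = 0 := by
        rw [AddCircle.coe_eq_zero_iff]; exact ⟨m', by simp⟩
      rw [this, add_zero]
    have hw0 : |0 - w| ≤ ε := by rwa [hw, ← sub_sub]
    have ind : ∀ i < n, |(0 + bsum f α i x) - (w + bsum f α i z)| ≤ ε := by
      intro i
      induction i with
      | zero => intro _; simpa [bsum] using hw0
      | succ i ih =>
        intro hi
        have h1 := ih (by omega)
        have h2 := hd (i + 1) hi
        rw [← hza, ← hwb, iter_formula α f F hF T hT, iter_formula α f F hF T hT,
          Prod.dist_eq] at h2
        have h3 := (le_max_right _ _).trans h2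
        simp only at h3
        rw [dist_eq_norm, ← AddCircle.coe_sub] at h3
        have h4 := hδ (x + i * α) (z + i * α) (by
          rw [add_sub_add_right_eq_sub]; exact hxa.trans hε1)
        have h5 : |0 + bsum f α (i + 1) x - (w + bsum f α (i + 1) z)| ≤ 1 / 2 := by
          have := abs_add_le (0 + bsum f α i x - (w + bsum f α i z)) (f (x + i * α) - f (z + i * α))
          have e : 0 + bsum f α (i + 1) x - (w + bsum f α (i + 1) z) =
            (0 + bsum f α i x - (w + bsum f α i z)) + (f (x + i * α) - f (z + i * α)) := by
            simp only [bsum, Finset.sum_range_succ]; ring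
          rw [e]; linarith
        rwa [(AddCircle.norm_coe_eq_abs_iff (1:ℝ) one_ne_zero).2 (by simpa using h5)] at h3
    intro i hi
    have h1 := ind i hi
    rw [abs_le] at h1 hw0 ⊢
    constructor <;> linarith
  have hcard : ((Fs ×ˢ M).card : ℝ) = Fs.card * 3 := by
    rw [Finset.card_product]
    have : M.card = 3 := by rw [hM]; rfl
    rw [this]; push_cast; ring
  have goal : ∀ _ : (n:ℝ) ≤ Fs.card * (24 * ε), 1 / (24 * ε) * n ≤ Fs.card := by
    intro h
    rw [one_div_mul_eq_div, div_le_iff₀ (by positivity)]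
    exact h
  apply goal
  rcases hn.eq_or_lt with h1 | h1
  · have := cover (Fs ×ˢ M) (fun k => ρ k.1.1 + k.2) id continuous_id ε hε.le
      (fun x hx => by
        obtain ⟨k, hk, h, _⟩ := main x hx
        exact ⟨k, hk, h⟩)
    rw [hcard] at this
    simp only [id, sub_zero, abs_one] at this
    have hp : 0 ≤ (Fs.card : ℝ) * ε := by positivity
    rw [← h1]
    push_cast
    linarith
  · have hc : Continuous (bsum f α (n - 1)) := by
      unfold bsum
      fun_prop
    have := cover (Fs ×ˢ M) (fun k => bsum f α (n - 1) (ρ k.1.1 + k.2)) _ hc (2 * ε)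
      (by positivity)
      (fun x hx => by
        obtain ⟨k, hk, _, h⟩ := main x hx
        exact ⟨k, hk, h (n - 1) (by omega)⟩)
    rw [hcard] at this
    have e : bsum f α (n - 1) 1 - bsum f α (n - 1) 0 = ((n - 1 : ℕ) : ℝ) * l := by
      have : ∀ j : ℕ, f (1 + j * α) - f (0 + j * α) = l := fun j => by
        rw [← hfl (0 + j * α)]; congr 2; ring
      simp only [bsum, ← Finset.sum_sub_distrib, this]
      simp
    have hl1 : (1:ℝ) ≤ |(l:ℝ)| := by exact_mod_cast Int.one_le_abs hl
    rw [e, abs_mul, Nat.abs_cast, Nat.cast_sub hn, Nat.cast_one] at this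
    have hn2 : (2:ℝ) ≤ n := by exact_mod_cast h1
    nlinarith

end Stmt3Aux

theorem stmt3 (l : ℤ) (hl : l ≠ 0) (α : ℝ) (hα : Irrational α)
    (f : ℝ → ℝ) (hf : Continuous f) (hfl : ∀ x : ℝ, f (x + 1) - f x = l)
    (hbv : BoundedVariationOn f (Icc (0:ℝ) 1))
    (F : Torus1 → Torus1) (hF : ∀ x : ℝ, F (x : Torus1) = ((f x : ℝ) : Torus1))
    (T : Torus2 → Torus2)
    (hT : ∀ p : Torus2, T p = (p.1 + (α : Torus1), F p.1 + p.2)) :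
    ∃ ε₀ > 0, ∃ c₁ c₂ : ℝ → ℝ,
      (∀ ε, 0 < ε → ε ≤ ε₀ → 0 < c₁ ε ∧ 0 < c₂ ε ∧
        ∀ n : ℕ, 1 ≤ n →
          c₁ ε * n ≤ (spanNum T n ε : ℝ) ∧ (spanNum T n ε : ℝ) ≤ c₂ ε * n) ∧
      Tendsto c₁ (nhdsWithin 0 (Ioi 0)) atTop := by
  obtain ⟨δ, hδ0, hδ⟩ := Stmt3Aux.unif l f hf hfl
  obtain ⟨C, hC, hup⟩ := Stmt3Aux.upper l α f hfl hbv F hF T hT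
  refine ⟨min δ (1 / 4), by positivity, fun ε => 1 / (24 * ε),
    fun ε => (2 * (C + 1) / ε + 1) * (2 / ε + 1), ?_, ?_⟩
  · intro ε hε hε0
    refine ⟨by positivity, by positivity, fun n hn => ?_⟩
    obtain ⟨Fs, hFs, hcard⟩ := hup ε hε n hn
    constructor
    · obtain ⟨Gs, hGs, hG⟩ := Nat.sInf_mem
        (s := {k : ℕ | ∃ Fset : Finset Torus2, IsSpanningSet T n ε Fset ∧ Fset.card = k})
        ⟨_, Fs, hFs, rfl⟩
      have := Stmt3Aux.lower l hl α f hf hfl F hF T hT δ hδ ε hε (hε0.trans (min_le_left _ _))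
        (hε0.trans (min_le_right _ _)) n hn Gs hGs
      rw [hG] at this
      exact this
    · refine le_trans ?_ hcard
      have : spanNum T n ε ≤ Fs.card := Nat.sInf_le ⟨Fs, hFs, rfl⟩
      exact_mod_cast this
  · have h : (fun ε : ℝ => 1 / (24 * ε)) = fun ε => (1 / 24) * ε⁻¹ := by
      funext ε
      rw [one_div, mul_inv, one_div]
    rw [h]
    exact tendsto_inv_nhdsGT_zero.const_mul_atTop (by norm_num)
end

section
/- Let f : ℝ → ℝ be continuous with f(x+1) - f(x) = l for all x, where l is a nonzero integer, and let α be irrational. Then the map T : 𝕋² → 𝕋², T(x,y) = (x+α, f(x)+y) is a minimal homeomorphism, i.e. every orbit {Tⁿ(p) : n ∈ ℤ} is dense in 𝕋². -/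
/-- A continuous integer valued function on `ℝ` is constant. -/
theorem aux_const (u : ℝ → ℝ) (hu : Continuous u) (h : ∀ x, ((u x : ℝ) : Torus1) = 0)
    (x y : ℝ) : u x = u y := by
  have h' : ∀ x, ∃ n : ℤ, (n : ℝ) = u x := by
    intro x
    have := h x
    rw [AddCircle.coe_eq_zero_iff] at this
    obtain ⟨n, hn⟩ := this
    exact ⟨n, by simpa using hn⟩
  choose n hn using h'
  have hc : Continuous n := by
    rw [Int.isClosedEmbedding_coe_real.isInducing.continuous_iff]
    have : ((fun z : ℤ => (z : ℝ)) ∘ n) = u := funext hn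
    rw [this]; exact hu
  have : n x = n y := PreconnectedSpace.constant inferInstance hc
  rw [← hn, ← hn, this]

/-- Continuous circle valued maps on the circle have no nontrivial degree coboundary. -/
theorem aux_degree (l : ℤ) (hl : l ≠ 0) (α : ℝ)
    (f : ℝ → ℝ) (hf : Continuous f) (hfl : ∀ x : ℝ, f (x + 1) - f x = l)
    (k : ℕ) (hk : k ≠ 0) (g : Torus1 → Torus1) (hg : Continuous g)
    (h : ∀ x : ℝ, g ((x : Torus1) + (α : Torus1)) = k • ((f x : ℝ) : Torus1) + g x) : False := by
  have hq : Continuous (fun x : ℝ => (x : Torus1)) := AddCircle.continuous_mk' 1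
  let g' : C(ℝ, Torus1) := ⟨fun x => g (x : Torus1), hg.comp hq⟩
  obtain ⟨e, he⟩ := QuotientAddGroup.mk_surjective (g' 0)
  obtain ⟨G, ⟨-, hG⟩, -⟩ :=
    (AddCircle.isCoveringMap_coe (1 : ℝ)).existsUnique_continuousMap_lifts g' 0 e he
  have hG' : ∀ x, ((G x : ℝ) : Torus1) = g (x : Torus1) := fun x => congrFun hG x
  have hGc : Continuous G := G.continuous
  have h1 := aux_const (fun x => G (x + 1) - G x) (by fun_prop) (by
    intro x
    rw [AddCircle.coe_sub, hG', hG', AddCircle.coe_add, AddCircle.coe_period, add_zero, sub_self])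
  have h2 := aux_const (fun x => G (x + α) - (k * f x + G x)) (by fun_prop) (by
    intro x
    have : (((k : ℝ) * f x : ℝ) : Torus1) = k • ((f x : ℝ) : Torus1) := by
      rw [← nsmul_eq_mul, AddCircle.coe_nsmul]
    rw [AddCircle.coe_sub, AddCircle.coe_add, hG', hG', AddCircle.coe_add, h, this, sub_self])
  have a1 := h1 0 α
  have a2 := h2 0 1
  have a3 := hfl 0
  simp only [zero_add] at a1 a2 a3
  rw [add_comm 1 α] at a2
  have : (k : ℝ) * l = 0 := by rw [← a3]; linarith
  rcases mul_eq_zero.1 this with h | h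
  · exact hk (by exact_mod_cast h)
  · exact hl (by exact_mod_cast h)

/-- A minimal nonempty closed forward invariant set exists in every such set. -/
theorem aux_minimal {X : Type*} [TopologicalSpace X] [CompactSpace X] (T : X → X)
    (C : Set X) (hC : IsClosed C) (hne : C.Nonempty) (hinv : ∀ p ∈ C, T p ∈ C) :
    ∃ M ⊆ C, IsClosed M ∧ M.Nonempty ∧ (∀ p ∈ M, T p ∈ M) ∧
      ∀ N ⊆ M, IsClosed N → N.Nonempty → (∀ p ∈ N, T p ∈ N) → N = M := by
  obtain ⟨M, hMC, hM⟩ := zorn_superset_nonempty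
    {S : Set X | IsClosed S ∧ S.Nonempty ∧ ∀ p ∈ S, T p ∈ S} (by
      intro c hc hch hcn
      have : Nonempty c := hcn.to_subtype
      refine ⟨⋂₀ c, ⟨isClosed_sInter fun s hs => (hc hs).1, ?_, ?_⟩,
        fun s hs => Set.sInter_subset_of_mem hs⟩
      · apply IsCompact.nonempty_sInter_of_directed_nonempty_isCompact_isClosed
        · intro A hA B hB
          rcases hch.total hA hB with h | h
          · exact ⟨A, hA, subset_rfl, h⟩
          · exact ⟨B, hB, h, subset_rfl⟩
        · exact fun U hU => (hc hU).2.1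
        · exact fun U hU => (hc hU).1.isCompact
        · exact fun U hU => (hc hU).1
      · intro p hp s hs
        exact (hc hs).2.2 p (hp s hs)) C ⟨hC, hne, hinv⟩
  refine ⟨M, hMC, hM.prop.1, hM.prop.2.1, hM.prop.2.2, fun N hN h1 h2 h3 => ?_⟩
  exact Set.Subset.antisymm hN (hM.le_of_le ⟨h1, h2, h3⟩ hN)

theorem stmt8 (l : ℤ) (hl : l ≠ 0) (α : ℝ) (hα : Irrational α)
    (f : ℝ → ℝ) (hf : Continuous f) (hfl : ∀ x : ℝ, f (x + 1) - f x = l)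
    (F : Torus1 → Torus1) (hF : ∀ x : ℝ, F (x : Torus1) = ((f x : ℝ) : Torus1))
    (T : Equiv.Perm Torus2)
    (hT : ∀ p : Torus2, T p = (p.1 + (α : Torus1), F p.1 + p.2)) :
    ∀ p : Torus2, Dense (Set.range fun n : ℤ => (T ^ n) p) := by
  intro p
  have hFc : Continuous F := by
    have hq : Topology.IsQuotientMap (fun x : ℝ => (x : Torus1)) := isQuotientMap_quotient_mk'
    rw [hq.continuous_iff]
    have : F ∘ (fun x : ℝ => (x : Torus1)) = fun x => ((f x : ℝ) : Torus1) := funext hF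
    rw [this]
    exact (AddCircle.continuous_mk' 1).comp hf
  have hTc : Continuous T := by
    have : (T : Torus2 → Torus2) = fun p => (p.1 + (α : Torus1), F p.1 + p.2) := funext hT
    rw [this]; fun_prop
  obtain ⟨M, hMC, hMcl, hMne, hMinv, hmin⟩ := aux_minimal T
    (closure (Set.range fun n : ℤ => (T ^ n) p)) isClosed_closure
    ((Set.range_nonempty _).closure) (by
      intro q hq
      refine map_mem_closure hTc hq ?_
      rintro _ ⟨n, rfl⟩
      exact ⟨1 + n, by simp [zpow_add]⟩)
  suffices hM : M = Set.univ by
    rw [dense_iff_closure_eq]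
    exact Set.eq_univ_of_univ_subset (hM ▸ hMC)
  have hTM : T '' M = M := by
    apply hmin
    · rintro _ ⟨q, hq, rfl⟩; exact hMinv q hq
    · exact (hMcl.isCompact.image hTc).isClosed
    · exact hMne.image _
    · rintro _ ⟨q, hq, rfl⟩; exact ⟨T q, hMinv q hq, rfl⟩
  -- the projection is onto
  have hproj : ∀ x : Torus1, ∃ y, (x, y) ∈ M := by
    obtain ⟨p0, hp0⟩ := hMne
    have hcl : IsClosed (Prod.fst '' M) := (hMcl.isCompact.image continuous_fst).isClosed
    have hstep : ∀ x ∈ Prod.fst '' M, x + (α : Torus1) ∈ Prod.fst '' M := by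
      rintro _ ⟨q, hq, rfl⟩
      exact ⟨T q, hMinv q hq, by rw [hT]⟩
    have hstep' : ∀ x ∈ Prod.fst '' M, x - (α : Torus1) ∈ Prod.fst '' M := by
      rintro _ ⟨q, hq, rfl⟩
      rw [← hTM] at hq
      obtain ⟨r, hr, rfl⟩ := hq
      exact ⟨r, hr, by rw [hT]; simp⟩
    have hall : ∀ n : ℤ, p0.1 + n • (α : Torus1) ∈ Prod.fst '' M := by
      intro n
      induction n using Int.induction_on with
      | zero => exact ⟨p0, hp0, by simp⟩
      | succ n ih => rw [add_zsmul, one_zsmul, ← add_assoc]; exact hstep _ ih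
      | pred n ih => rw [sub_zsmul, one_zsmul, ← add_assoc, ← sub_eq_add_neg]; exact hstep' _ ih
    have hd : DenseRange (· • (α : Torus1) : ℤ → Torus1) :=
      AddCircle.denseRange_zsmul_coe_iff.2 (by simpa using hα)
    intro x
    have hx : x - p0.1 ∈ (fun z => p0.1 + z) ⁻¹' (Prod.fst '' M) := by
      have hc2 : IsClosed ((fun z => p0.1 + z) ⁻¹' (Prod.fst '' M)) :=
        hcl.preimage (by fun_prop)
      refine hc2.closure_subset_iff.2 ?_ (hd (x - p0.1))
      rintro _ ⟨n, rfl⟩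
      exact hall n
    obtain ⟨⟨a, b⟩, hq, hqx⟩ := hx
    refine ⟨b, ?_⟩
    have : a = x := by simpa using hqx
    exact this ▸ hq
  -- vertical translations
  have htr : ∀ c : Torus1, (∃ q ∈ M, (q.1, q.2 + c) ∈ M) → ∀ q ∈ M, (q.1, q.2 + c) ∈ M := by
    rintro c ⟨q, hq, hqc⟩
    have := hmin (M ∩ (fun q : Torus2 => (q.1, q.2 + c)) ⁻¹' M) Set.inter_subset_left
      (hMcl.inter (hMcl.preimage (by fun_prop))) ⟨q, hq, hqc⟩ (by
        rintro r ⟨hr, hrc⟩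
        refine ⟨hMinv r hr, ?_⟩
        have := hMinv _ hrc
        rw [hT] at this
        simp only [Set.mem_preimage]
        rw [hT]
        simpa [add_assoc] using this)
    intro r hr
    rw [← this] at hr
    exact hr.2
  let H : AddSubgroup Torus1 :=
    { carrier := {c | ∀ q ∈ M, (q.1, q.2 + c) ∈ M}
      zero_mem' := by intro q hq; simpa using hq
      add_mem' := by
        intro a b ha hb q hq
        simpa [add_assoc] using hb _ (ha q hq)
      neg_mem' := by
        intro a ha
        obtain ⟨q, hq⟩ := hMne
        exact htr _ ⟨_, ha q hq, by simpa using hq⟩ }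
  have hHcl : IsClosed (H : Set Torus1) := by
    have : (H : Set Torus1) = ⋂ q ∈ M, (fun c : Torus1 => (q.1, q.2 + c)) ⁻¹' M := by
      ext c; simp [H]
    rw [this]
    exact isClosed_biInter fun q _ => hMcl.preimage (by fun_prop)
  by_cases hd : Dense (H : Set Torus1)
  · have hall : (H : Set Torus1) = Set.univ := by rw [← hHcl.closure_eq, hd.closure_eq]
    ext ⟨x, y⟩
    simp only [Set.mem_univ, iff_true]
    obtain ⟨y', hy'⟩ := hproj x
    have : y - y' ∈ (H : Set Torus1) := by rw [hall]; trivial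
    simpa using this _ hy'
  · exfalso
    rw [AddCircle.dense_addSubgroup_iff_ne_zmultiples] at hd
    push Not at hd
    obtain ⟨a, ha, hHa⟩ := hd
    have huniq : ∀ x y y', (x, y) ∈ M → (x, y') ∈ M →
        addOrderOf a • y = addOrderOf a • y' := by
      intro x y y' h h'
      have : y' - y ∈ H := htr (y' - y) ⟨(x, y), h, by simpa using h'⟩
      rw [hHa, AddSubgroup.mem_zmultiples_iff] at this
      obtain ⟨n, hn⟩ := this
      have h0 : addOrderOf a • (y' - y) = 0 := by
        rw [← hn, smul_comm, addOrderOf_nsmul_eq_zero, smul_zero]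
      rw [smul_sub, sub_eq_zero] at h0
      exact h0.symm
    choose s hs using hproj
    have hgc : Continuous (fun x => addOrderOf a • s x) := by
      have : CompactSpace M := isCompact_iff_compactSpace.1 hMcl.isCompact
      have hπ : Continuous (fun q : M => q.1.1) := by fun_prop
      have hq : Topology.IsQuotientMap (fun q : M => q.1.1) :=
        hπ.isClosedMap.isQuotientMap hπ (fun x => ⟨⟨(x, s x), hs x⟩, rfl⟩)
      rw [hq.continuous_iff]
      have : (fun x => addOrderOf a • s x) ∘ (fun q : M => q.1.1) =
          fun q : M => addOrderOf a • q.1.2 :=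
        funext fun q => huniq q.1.1 _ _ (hs _) q.2
      rw [this]
      fun_prop
    refine aux_degree l hl α f hf hfl (addOrderOf a) ha _ hgc fun x => ?_
    rw [← smul_add, ← hF]
    refine huniq _ _ _ (hs _) ?_
    have := hMinv _ (hs (x : Torus1))
    rwa [hT] at this
end

section
/- Let α be irrational with ν(2πα) = 0, where ν(β) = liminf_{n→∞} n‖nβ‖. Then for any nonzero integer l there exists a continuous function f : ℝ → ℝ of bounded variation on [0,1] with f(x+1) - f(x) = l for all x, such that f cannot be written as f(x) = φ(x+α) - φ(x) + lx + c for any continuous 1-periodic φ and constant c. -/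
open Set Filter

/-- Riemann-Lebesgue in complex form on `[0,1]`. -/
lemma rl_complex (g : ℝ → ℝ) :
    Tendsto (fun n : ℕ => ∫ x in (0:ℝ)..1, Complex.exp ((-(2 * Real.pi * n * x) : ℝ) * Complex.I) * (g x : ℂ))
      atTop (nhds 0) := by
  have h := Real.tendsto_integral_exp_smul_cocompact
    (fun x => Set.indicator (Ioc (0:ℝ) 1) (fun x => (g x : ℂ)) x)
  have h2 : Tendsto (fun n : ℕ => (n : ℝ)) atTop (cocompact ℝ) :=
    tendsto_natCast_atTop_atTop.mono_right atTop_le_cocompact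
  have h3 := h.comp h2
  refine h3.congr fun n => ?_
  simp only [Function.comp]
  rw [intervalIntegral.integral_of_le zero_le_one, ← MeasureTheory.integral_indicator measurableSet_Ioc]
  refine MeasureTheory.integral_congr_ae (Eventually.of_forall fun x => ?_)
  by_cases hx : x ∈ Ioc (0:ℝ) 1
  · simp only [hx, indicator_of_mem]
    rw [Circle.smul_def, Real.fourierChar_apply, smul_eq_mul]
    congr 3
    push_cast; ring
  · simp [hx]

lemma rl_int (g : ℝ → ℝ) (hg : Continuous g) (n : ℕ) :
    IntervalIntegrable (fun x : ℝ => Complex.exp ((-(2 * Real.pi * n * x) : ℝ) * Complex.I) * (g x : ℂ))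
      MeasureTheory.volume 0 1 := by
  apply Continuous.intervalIntegrable
  fun_prop

lemma rl_cos (g : ℝ → ℝ) (hg : Continuous g) :
    Tendsto (fun n : ℕ => ∫ x in (0:ℝ)..1, g x * Real.cos (2 * Real.pi * n * x)) atTop (nhds 0) := by
  have h := (Complex.continuous_re.tendsto 0).comp (rl_complex g)
  simp only [Complex.zero_re] at h
  refine h.congr fun n => ?_
  simp only [Function.comp]
  have := Complex.reCLM.intervalIntegral_comp_comm (rl_int g hg n)
  simp only [Complex.reCLM_apply] at this
  rw [← this]
  refine intervalIntegral.integral_congr fun x _ => ?_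
  simp only [Complex.re_mul_ofReal, Complex.exp_ofReal_mul_I_re, Real.cos_neg]
  ring

lemma rl_sin (g : ℝ → ℝ) (hg : Continuous g) :
    Tendsto (fun n : ℕ => ∫ x in (0:ℝ)..1, g x * Real.sin (2 * Real.pi * n * x)) atTop (nhds 0) := by
  have h := ((Complex.continuous_im.tendsto 0).comp (rl_complex g)).neg
  simp only [Complex.zero_im, neg_zero] at h
  refine h.congr fun n => ?_
  simp only [Function.comp]
  have := Complex.imCLM.intervalIntegral_comp_comm (rl_int g hg n)
  simp only [Complex.imCLM_apply] at this
  rw [← this, ← intervalIntegral.integral_neg]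
  refine intervalIntegral.integral_congr fun x _ => ?_
  simp only [Complex.im_mul_ofReal, Complex.exp_ofReal_mul_I_im, Real.sin_neg]
  ring

/-- Dirichlet: infinitely many good denominators. -/
lemma dirichlet (α : ℝ) (hα : Irrational α) (N : ℕ) :
    ∃ n : ℕ, N ≤ n ∧ 0 < n ∧ ∃ m : ℤ, |n * α - m| ≤ 1 / n := by
  by_contra! hcon
  apply Real.infinite_rat_abs_sub_lt_one_div_den_sq_of_irrational hα
  have hfin : ((Icc (-(⌈(|α| + 1) * N⌉)) ⌈(|α| + 1) * N⌉ ×ˢ Icc 0 N : Set (ℤ × ℕ))).Finite :=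
    (Set.finite_Icc _ _).prod (Set.finite_Icc _ _)
  refine (hfin.preimage (f := fun q : ℚ => (q.num, q.den)) ?_).subset ?_
  · intro a _ b _ hab
    simp only [Prod.mk.injEq] at hab
    exact Rat.ext hab.1 hab.2
  · intro q hq
    simp only [mem_ofPred_eq] at hq
    have hd : (0:ℝ) < q.den := by exact_mod_cast q.den_pos
    have hd1 : (1:ℝ) ≤ q.den := by exact_mod_cast q.den_pos
    have hqe : (q : ℝ) = q.num / q.den := by exact_mod_cast (Rat.num_div_den q).symm
    have hmul : |q.den * α - q.num| < 1 / q.den := by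
      have : q.den * α - q.num = q.den * (α - q) := by rw [hqe]; field_simp
      rw [this, abs_mul, abs_of_pos hd]
      calc (q.den : ℝ) * |α - q| < q.den * (1 / (q.den : ℝ) ^ 2) := by gcongr
        _ = 1 / q.den := by field_simp
    have hdN : q.den ≤ N := by
      by_contra! h
      have := hcon q.den h.le q.den_pos q.num
      linarith
    have hdN' : (q.den : ℝ) ≤ N := by exact_mod_cast hdN
    have h1 : (1:ℝ) / q.den ≤ 1 := by rw [div_le_one hd]; exact hd1
    have hn : |(q.num : ℝ)| ≤ (|α| + 1) * N := by
      have h2 : |(q.num : ℝ)| ≤ |q.den * α| + |q.den * α - q.num| := by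
        have := abs_sub (q.den * α : ℝ) (q.den * α - q.num)
        simpa using this
      rw [abs_mul, abs_of_pos hd] at h2
      nlinarith [abs_nonneg α]
    have hn' := abs_le.1 hn
    have hc := Int.le_ceil ((|α| + 1) * (N:ℝ))
    simp only [mem_preimage, mem_prod, mem_Icc]
    refine ⟨⟨?_, ?_⟩, Nat.zero_le _, hdN⟩
    · have : ((-⌈(|α| + 1) * (N:ℝ)⌉ : ℤ) : ℝ) ≤ q.num := by push_cast; linarith
      exact_mod_cast this
    · have : (q.num : ℝ) ≤ ⌈(|α| + 1) * (N:ℝ)⌉ := by linarith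
      exact_mod_cast this

structure Good (H : ℝ → ℝ) : Prop where
  smooth : ContDiff ℝ 1 H
  mono : Monotone H
  deg : ∀ x, H (x + 1) = H x + 1
  lip : ∃ L : ℝ, 0 ≤ L ∧ ∀ x y, |H x - H y| ≤ L * |x - y|

/-- The small oscillation. -/
noncomputable def osc (n : ℕ) (x : ℝ) : ℝ := Real.sin (2 * Real.pi * n * x) / (2 * Real.pi * n)

lemma osc_lip (n : ℕ) (hn : 0 < n) (x y : ℝ) : |osc n x - osc n y| ≤ |x - y| := by
  have h : (0:ℝ) < 2 * Real.pi * n := by positivity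
  unfold osc
  rw [← sub_div, abs_div, abs_of_pos h, div_le_iff₀ h]
  refine (Real.abs_sin_sub_sin_le _ _).trans ?_
  rw [← mul_sub, abs_mul, abs_of_pos h, mul_comm]

lemma osc_bound (n : ℕ) (hn : 0 < n) (x : ℝ) : |osc n x| ≤ 1 / n := by
  have h : (0:ℝ) < 2 * Real.pi * n := by positivity
  have hn' : (0:ℝ) < n := by positivity
  unfold osc
  rw [abs_div, abs_of_pos h, div_le_div_iff₀ h hn']
  have := Real.abs_sin_le_one (2 * Real.pi * n * x)
  nlinarith [Real.pi_gt_three, abs_nonneg (Real.sin (2 * Real.pi * n * x))]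

lemma osc_cont (n : ℕ) : Continuous (osc n) := by unfold osc; fun_prop

lemma Good.comp_osc {H : ℝ → ℝ} (hH : Good H) (n : ℕ) (hn : 0 < n) :
    Good (fun x => H (x + osc n x)) := by
  refine ⟨?_, ?_, ?_, ?_⟩
  · have : ContDiff ℝ 1 (fun x => x + osc n x) := by unfold osc; fun_prop
    exact hH.smooth.comp this
  · intro x y hxy
    apply hH.mono
    have := (abs_le.1 (osc_lip n hn x y)).2
    rw [abs_of_nonpos (by linarith)] at this
    linarith
  · intro x
    have : osc n (x + 1) = osc n x := by
      unfold osc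
      congr 1
      have : 2 * Real.pi * n * (x + 1) = 2 * Real.pi * n * x + n * (2 * Real.pi) := by ring
      rw [this, Real.sin_add_nat_mul_two_pi]
    simp only [this]
    rw [← hH.deg]; congr 1; ring
  · obtain ⟨L, hL, h⟩ := hH.lip
    refine ⟨L * 2, by positivity, fun x y => (h _ _).trans ?_⟩
    rw [mul_assoc]
    gcongr
    have : x + osc n x - (y + osc n y) = (x - y) + (osc n x - osc n y) := by ring
    rw [this]
    have := abs_add_le (x - y) (osc n x - osc n y)
    linarith [osc_lip n hn x y]

lemma Good.hasDeriv {H : ℝ → ℝ} (hH : Good H) (x : ℝ) : HasDerivAt H (deriv H x) x :=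
  ((hH.smooth.differentiable (by norm_num)) x).hasDerivAt

lemma Good.cont_deriv {H : ℝ → ℝ} (hH : Good H) : Continuous (deriv H) :=
  hH.smooth.continuous_deriv (by norm_num)

lemma Good.lim1 {H : ℝ → ℝ} (hH : Good H) :
    Tendsto (fun n : ℕ => n * ∫ x in (0:ℝ)..1, (H x - x) * Real.sin (2 * Real.pi * n * x))
      atTop (nhds 0) := by
  have hc := hH.cont_deriv
  have hc0 := hH.smooth.continuous
  have h := (rl_cos (fun x => deriv H x - 1) (by fun_prop)).const_mul (1 / (2 * Real.pi))
  rw [mul_zero] at h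
  refine h.congr fun n => ?_
  have hd : ∀ x, HasDerivAt (fun x => (H x - x) * Real.cos (2 * Real.pi * n * x))
      ((deriv H x - 1) * Real.cos (2 * Real.pi * n * x)
        - 2 * Real.pi * n * ((H x - x) * Real.sin (2 * Real.pi * n * x))) x := by
    intro x
    have h1 : HasDerivAt (fun x : ℝ => 2 * Real.pi * n * x) (2 * Real.pi * n) x := by
      simpa using (hasDerivAt_id x).const_mul (2 * Real.pi * n)
    have h2 : HasDerivAt (fun x => H x - x) (deriv H x - 1) x :=
      (hH.hasDeriv x).sub (hasDerivAt_id x)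
    exact (h2.mul h1.cos).congr_deriv (by ring)
  have hi := intervalIntegral.integral_eq_sub_of_hasDerivAt (a := 0) (b := 1) (fun x _ => hd x)
    (Continuous.intervalIntegrable (by fun_prop) _ _)
  rw [intervalIntegral.integral_sub (Continuous.intervalIntegrable (by fun_prop) _ _)
    (Continuous.intervalIntegrable (by fun_prop) _ _), intervalIntegral.integral_const_mul] at hi
  have h01 : H 1 = H 0 + 1 := by simpa using hH.deg 0
  have hcos : Real.cos (2 * Real.pi * n * 1) = 1 := by
    rw [show 2 * Real.pi * n * 1 = n * (2 * Real.pi) by ring, Real.cos_nat_mul_two_pi]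
  rw [hcos, h01] at hi
  simp only [mul_zero, Real.cos_zero] at hi
  have hi' : (∫ x in (0:ℝ)..1, (deriv H x - 1) * Real.cos (2 * Real.pi * n * x))
    = 2 * Real.pi * n * ∫ x in (0:ℝ)..1, (H x - x) * Real.sin (2 * Real.pi * n * x) := by linarith
  rw [hi']
  field_simp

lemma Good.lim2 {H : ℝ → ℝ} (hH : Good H) :
    Tendsto (fun n : ℕ => ∫ x in (0:ℝ)..1, deriv H x * Real.sin (2 * Real.pi * n * x) ^ 2)
      atTop (nhds (1 / 2)) := by
  have hc := hH.cont_deriv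
  have h2 : Tendsto (fun n : ℕ => 2 * n) atTop atTop :=
    tendsto_id.const_mul_atTop' (by norm_num)
  have h := (((rl_cos (deriv H) hc).comp h2).const_mul (1/2)).const_sub (1/2)
  rw [mul_zero, sub_zero] at h
  refine h.congr fun n => ?_
  have hi := intervalIntegral.integral_eq_sub_of_hasDerivAt (a := 0) (b := 1)
    (fun x _ => hH.hasDeriv x) (hc.intervalIntegrable _ _)
  have h01 : H 1 = H 0 + 1 := by simpa using hH.deg 0
  have hi' : ∫ x in (0:ℝ)..1, deriv H x = 1 := by rw [hi]; linarith
  simp only [Function.comp]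
  rw [← intervalIntegral.integral_const_mul]
  have : (1/2 : ℝ) = ∫ x in (0:ℝ)..1, (1/2) * deriv H x := by
    rw [intervalIntegral.integral_const_mul, hi']; norm_num
  nth_rewrite 1 [this]
  rw [← intervalIntegral.integral_sub (Continuous.intervalIntegrable (by fun_prop) _ _)
    (Continuous.intervalIntegrable (by fun_prop) _ _)]
  refine intervalIntegral.integral_congr fun x _ => ?_
  beta_reduce
  have : 2 * Real.pi * ((2 * n : ℕ) : ℝ) * x = 2 * (2 * Real.pi * n * x) := by push_cast; ring
  rw [this, Real.cos_two_mul, Real.cos_sq']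
  ring

lemma Good.lim3 {H : ℝ → ℝ} (hH : Good H) :
    Tendsto (fun n : ℕ => ∫ x in (0:ℝ)..1, (n * (H (x + osc n x) - H x) * Real.sin (2 * Real.pi * n * x)
      - 1 / (2 * Real.pi) * (deriv H x * Real.sin (2 * Real.pi * n * x) ^ 2)))
      atTop (nhds 0) := by
  have hc := hH.cont_deriv
  have hc0 := hH.smooth.continuous
  obtain ⟨L, hL, hlip⟩ := hH.lip
  have key : ∀ n : ℕ, 0 < n → ∀ x, 1 / (2 * Real.pi) * (deriv H x * Real.sin (2 * Real.pi * n * x) ^ 2)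
      = n * (deriv H x * osc n x) * Real.sin (2 * Real.pi * n * x) := by
    intro n hn x
    unfold osc
    have : (n:ℝ) ≠ 0 := by positivity
    field_simp
  have hz : (0:ℝ) = ∫ x in (0:ℝ)..1, (0:ℝ) := by simp
  have hz' : nhds (0:ℝ) = nhds (∫ x in (0:ℝ)..1, (0:ℝ)) := by rw [← hz]
  rw [hz']
  apply intervalIntegral.tendsto_integral_filter_of_dominated_convergence (fun x => L + |deriv H x|)
  · refine Eventually.of_forall fun n => Continuous.aestronglyMeasurable ?_
    have := osc_cont n
    fun_prop
  · filter_upwards [eventually_gt_atTop 0] with n hn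
    refine Eventually.of_forall fun x _ => ?_
    rw [key n hn x, ← sub_mul, ← mul_sub, Real.norm_eq_abs, abs_mul, abs_mul]
    have hn' : (0:ℝ) < n := by positivity
    have h1 := osc_bound n hn x
    have h2 : |H (x + osc n x) - H x - deriv H x * osc n x| ≤ (L + |deriv H x|) * (1 / n) := by
      refine (abs_sub _ _).trans ?_
      have := hlip (x + osc n x) x
      rw [add_sub_cancel_left] at this
      rw [abs_mul]
      nlinarith [abs_nonneg (deriv H x)]
    have h0 : 0 ≤ L + |deriv H x| := by positivity
    rw [abs_of_pos hn']
    calc (n:ℝ) * |H (x + osc n x) - H x - deriv H x * osc n x| * |Real.sin (2 * Real.pi * n * x)|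
        ≤ n * ((L + |deriv H x|) * (1 / n)) * 1 := by
          gcongr; exact Real.abs_sin_le_one _
      _ = L + |deriv H x| := by field_simp
  · exact Continuous.intervalIntegrable (by fun_prop) _ _
  · refine Eventually.of_forall fun x _ => ?_
    rw [Metric.tendsto_atTop]
    intro ε hε
    have hd := (hasDerivAt_iff_isLittleO_nhds_zero.1 (hH.hasDeriv x)).def (half_pos hε)
    rw [Metric.eventually_nhds_iff] at hd
    obtain ⟨δ, hδ, hd⟩ := hd
    obtain ⟨N, hN⟩ := exists_nat_gt (1 / δ)
    refine ⟨N + 1, fun n hn => ?_⟩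
    have hn0 : 0 < n := by omega
    have hn' : (0:ℝ) < n := by positivity
    have hNn : (N:ℝ) ≤ n := by exact_mod_cast (by omega : N ≤ n)
    have h1 := osc_bound n hn0 x
    have hlt : |osc n x| < δ := by
      refine h1.trans_lt ?_
      rw [div_lt_comm₀ hn' hδ]; linarith
    have h2 := hd (y := osc n x) (by simpa using hlt)
    rw [Real.norm_eq_abs, Real.norm_eq_abs, smul_eq_mul] at h2
    rw [dist_zero_right, key n hn0 x, ← sub_mul, ← mul_sub, Real.norm_eq_abs, abs_mul, abs_mul,
      abs_of_pos hn']
    rw [mul_comm (deriv H x)]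
    calc (n:ℝ) * |H (x + osc n x) - H x - osc n x * deriv H x| * |Real.sin (2 * Real.pi * n * x)|
        ≤ n * (ε / 2 * (1 / n)) * 1 := by
          gcongr
          · exact h2.trans (by gcongr)
          · exact Real.abs_sin_le_one _
      _ = ε / 2 := by field_simp
      _ < ε := by linarith

lemma Good.lim {H : ℝ → ℝ} (hH : Good H) :
    Tendsto (fun n : ℕ => n * ∫ x in (0:ℝ)..1, (H (x + osc n x) - x) * Real.sin (2 * Real.pi * n * x))
      atTop (nhds (1 / (2 * Real.pi) * (1 / 2))) := by
  have hc := hH.cont_deriv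
  have hc0 := hH.smooth.continuous
  have h := (hH.lim1.add hH.lim3).add (hH.lim2.const_mul (1 / (2 * Real.pi)))
  simp only [zero_add] at h
  refine h.congr fun n => ?_
  have := osc_cont n
  rw [← intervalIntegral.integral_const_mul, ← intervalIntegral.integral_const_mul,
    ← intervalIntegral.integral_const_mul,
    ← intervalIntegral.integral_add, ← intervalIntegral.integral_add]
  · refine intervalIntegral.integral_congr fun x _ => ?_
    beta_reduce
    ring
  all_goals exact Continuous.intervalIntegrable (by fun_prop) _ _

def Dio (α : ℝ) (n : ℕ) : Prop := 0 < n ∧ ∃ m : ℤ, |n * α - m| ≤ 1 / n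

lemma step (α : ℝ) (hα : Irrational α) (H : ℝ → ℝ) (hH : Good H) (ε : ℝ) (hε : 0 < ε) (N : ℕ) :
    ∃ (n : ℕ) (H' : ℝ → ℝ), N < n ∧ Good H' ∧ (∀ x, |H x - H' x| ≤ ε) ∧ Dio α n ∧
      1 / 32 ≤ n * ∫ x in (0:ℝ)..1, (H' x - x) * Real.sin (2 * Real.pi * n * x) := by
  obtain ⟨L, hL, hlip⟩ := hH.lip
  have hlim : (1:ℝ)/32 < 1 / (2 * Real.pi) * (1 / 2) := by
    rw [one_div_mul_one_div]
    apply one_div_lt_one_div_of_lt (by positivity)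
    linarith [Real.pi_lt_four]
  obtain ⟨N1, hN1⟩ := eventually_atTop.1 (hH.lim.eventually (lt_mem_nhds hlim))
  obtain ⟨N2, hN2⟩ := exists_nat_gt (L / ε)
  obtain ⟨n, hn, hn0, hm⟩ := dirichlet α hα (N + 1 + N1 + N2)
  have hn' : (0:ℝ) < n := by positivity
  refine ⟨n, fun x => H (x + osc n x), by omega, hH.comp_osc n hn0, fun x => ?_, ⟨hn0, hm⟩,
    (hN1 n (by omega)).le⟩
  have := hlip x (x + osc n x)
  rw [sub_add_cancel_left, abs_neg] at this
  refine this.trans ?_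
  have h2 : (N2:ℝ) ≤ n := by exact_mod_cast (by omega : N2 ≤ n)
  calc L * |osc n x| ≤ L * (1 / n) := by gcongr; exact osc_bound n hn0 x
    _ = L / n := by ring
    _ ≤ ε := by
      rw [div_le_iff₀ hn']
      rw [div_lt_iff₀ hε] at hN2
      nlinarith

lemma good_id : Good (fun x => x) := by
  refine ⟨contDiff_id, monotone_id, fun x => rfl, 1, zero_le_one, fun x y => by simp⟩

lemma exists_F (α : ℝ) (hα : Irrational α) :
    ∃ F : ℝ → ℝ, Continuous F ∧ Monotone F ∧ (∀ x, F (x + 1) = F x + 1) ∧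
      ∀ N : ℕ, ∃ n : ℕ, N ≤ n ∧ Dio α n ∧
        1 / 100 ≤ n * ∫ x in (0:ℝ)..1, (F x - x) * Real.sin (2 * Real.pi * n * x) := by
  choose! nn HH h1 h2 h3 h4 h5 using step α hα
  -- state : function together with its frequency
  let st : ℕ → (ℝ → ℝ) × ℕ := fun k => Nat.rec (fun x => x, 1)
    (fun k p => (HH p.1 ((1/2)^k / (100 * p.2)) p.2, nn p.1 ((1/2)^k / (100 * p.2)) p.2)) k
  let G : ℕ → ℝ → ℝ := fun k => (st k).1
  let m : ℕ → ℕ := fun k => (st k).2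
  have hGs : ∀ k, G (k+1) = HH (G k) ((1/2)^k / (100 * m k)) (m k) := fun k => rfl
  have hms : ∀ k, m (k+1) = nn (G k) ((1/2)^k / (100 * m k)) (m k) := fun k => rfl
  have hbase : ∀ k, Good (G k) ∧ 0 < m k := by
    intro k
    induction k with
    | zero => exact ⟨good_id, one_pos⟩
    | succ k ih =>
      have hp : (0:ℝ) < (1/2)^k / (100 * m k) := by
        have := ih.2
        positivity
      refine ⟨?_, ?_⟩
      · rw [hGs]; exact h2 _ ih.1 _ hp _
      · rw [hms]; exact lt_of_le_of_lt (Nat.zero_le _) (h1 _ ih.1 _ hp _)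
  have hp : ∀ k, (0:ℝ) < (1/2)^k / (100 * m k) := fun k => by
    have := (hbase k).2
    positivity
  have hm_mono : StrictMono m := strictMono_nat_of_lt_succ fun k => by
    rw [hms]; exact h1 _ (hbase k).1 _ (hp k) _
  have hdist : ∀ k x, |G k x - G (k+1) x| ≤ (1/2)^k / (100 * m k) := fun k => by
    rw [hGs]; exact h3 _ (hbase k).1 _ (hp k) _
  have hdio : ∀ k, Dio α (m (k+1)) := fun k => by
    rw [hms]; exact h4 _ (hbase k).1 _ (hp k) _
  have hint : ∀ k, 1 / 32 ≤ m (k+1) * ∫ x in (0:ℝ)..1, (G (k+1) x - x) *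
      Real.sin (2 * Real.pi * m (k+1) * x) := fun k => by
    rw [hms, hGs]; exact h5 _ (hbase k).1 _ (hp k) _
  have hgeo : ∀ k x j, dist (G (k+j) x) (G (k+j+1) x) ≤ (1 / (50 * m k)) / 2 / 2^j := by
    intro k x j
    rw [Real.dist_eq]
    refine (hdist (k+j) x).trans ?_
    have hk : (0:ℝ) < m k := by exact_mod_cast (hbase k).2
    have hkj : (m k : ℝ) ≤ m (k+j) := by exact_mod_cast hm_mono.monotone (Nat.le_add_right k j)
    have e : (1 / (50 * (m k:ℝ))) / 2 / 2^j = (1/2)^j / (100 * m k) := by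
      rw [one_div_pow]; field_simp; norm_num
    rw [e]
    have hpw : ((1:ℝ)/2)^(k+j) ≤ (1/2)^j :=
      pow_le_pow_of_le_one (by norm_num) (by norm_num) (by omega)
    gcongr ?_ / (100 * ?_)
  have hcau : ∀ x, ∃ y, Tendsto (fun k => G k x) atTop (nhds y) := fun x => by
    apply cauchySeq_tendsto_of_complete
    apply cauchySeq_of_le_geometric_two (C := 1 / (50 * m 0))
    intro j
    simpa using hgeo 0 x j
  choose F hF using hcau
  have hFd : ∀ k x, |G k x - F x| ≤ 1 / (50 * m k) := by
    intro k x
    have ht : Tendsto (fun j => G (k + j) x) atTop (nhds (F x)) := by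
      have := (tendsto_add_atTop_iff_nat k).2 (hF x)
      simpa [add_comm] using this
    have := dist_le_of_le_geometric_two_of_tendsto₀ (C := 1 / (50 * m k))
      (f := fun j => G (k+j) x) (fun j => hgeo k x j) ht
    simpa [Real.dist_eq] using this
  have hFc : Continuous F := by
    have hu : TendstoUniformly G F atTop := by
      rw [Metric.tendstoUniformly_iff]
      intro ε hε
      obtain ⟨N, hN⟩ := exists_nat_gt (1 / ε)
      filter_upwards [eventually_ge_atTop (N+1)] with k hk x
      rw [dist_comm, Real.dist_eq]
      refine (hFd k x).trans_lt ?_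
      have h1 : k ≤ m k := hm_mono.le_apply
      have h2 : (N:ℝ) ≤ m k := by exact_mod_cast (by omega : N ≤ m k)
      have h3 : (0:ℝ) < m k := by exact_mod_cast (hbase k).2
      rw [div_lt_comm₀ (by positivity) hε]
      linarith
    exact hu.continuous (Frequently.of_forall fun k => (hbase k).1.smooth.continuous)
  refine ⟨F, hFc, ?_, ?_, ?_⟩
  · intro x y hxy
    exact le_of_tendsto_of_tendsto' (hF x) (hF y) fun k => (hbase k).1.mono hxy
  · intro x
    refine tendsto_nhds_unique (hF (x+1)) (((hF x).add_const 1).congr fun k => ?_)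
    exact ((hbase k).1.deg x).symm
  · intro N
    refine ⟨m (N+1), (Nat.le_succ N).trans hm_mono.le_apply, hdio N, ?_⟩
    have hk := hint N
    have hd := hFd (N+1)
    have hm0 : (0:ℝ) < m (N+1) := by exact_mod_cast (hbase (N+1)).2
    have hGc := (hbase (N+1)).1.smooth.continuous
    generalize m (N+1) = n at *
    generalize G (N+1) = g at *
    have hdiff : (∫ x in (0:ℝ)..1, (g x - x) * Real.sin (2 * Real.pi * n * x))
        - (∫ x in (0:ℝ)..1, (F x - x) * Real.sin (2 * Real.pi * n * x)) ≤ 1 / (50 * n) := by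
      rw [← intervalIntegral.integral_sub (Continuous.intervalIntegrable (by fun_prop) _ _)
        (Continuous.intervalIntegrable (by fun_prop) _ _)]
      refine (le_abs_self _).trans ?_
      have := intervalIntegral.norm_integral_le_of_norm_le_const (a := 0) (b := 1)
        (C := 1 / (50 * n)) (f := fun x => (g x - x) * Real.sin (2 * Real.pi * n * x)
          - (F x - x) * Real.sin (2 * Real.pi * n * x)) (fun x _ => by
          rw [← sub_mul, sub_sub_sub_cancel_right, Real.norm_eq_abs, abs_mul]
          calc _ ≤ (1 / (50 * (n:ℝ))) * 1 := by
                gcongr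
                · exact hd x
                · exact Real.abs_sin_le_one _
            _ = _ := mul_one _)
      simpa using this
    have h5 : (n:ℝ) * (1 / (50 * n)) = 1 / 50 := by field_simp
    nlinarith

lemma pairing (α : ℝ) (φ : ℝ → ℝ) (c : ℝ) (hφ : Continuous φ) (hper : ∀ x, φ (x + 1) = φ x)
    (n : ℕ) (hn : 0 < n) :
    ∫ x in (0:ℝ)..1, (φ (x + α) - φ x + c) * Real.sin (2 * Real.pi * n * x) =
      (Real.cos (2 * Real.pi * n * α) - 1) * (∫ x in (0:ℝ)..1, φ x * Real.sin (2 * Real.pi * n * x))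
      - Real.sin (2 * Real.pi * n * α) * (∫ x in (0:ℝ)..1, φ x * Real.cos (2 * Real.pi * n * x)) := by
  have hn' : (n:ℝ) ≠ 0 := by positivity
  have hs : ∫ x in (0:ℝ)..1, Real.sin (2 * Real.pi * n * x) = 0 := by
    rw [intervalIntegral.integral_comp_mul_left _ (by positivity), integral_sin]
    simp only [mul_zero, mul_one, Real.cos_zero]
    rw [show 2 * Real.pi * n = n * (2 * Real.pi) by ring, Real.cos_nat_mul_two_pi]
    simp
  have hshift : ∫ x in (0:ℝ)..1, φ (x + α) * Real.sin (2 * Real.pi * n * x) =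
      ∫ x in (0:ℝ)..1, φ x * Real.sin (2 * Real.pi * n * (x - α)) := by
    have hP : Function.Periodic (fun x => φ x * Real.sin (2 * Real.pi * n * (x - α))) 1 := by
      intro x
      simp only [hper]
      rw [show 2 * Real.pi * n * (x + 1 - α) = 2 * Real.pi * n * (x - α) + n * (2 * Real.pi) by ring,
        Real.sin_add_nat_mul_two_pi]
    have h1 := hP.intervalIntegral_add_eq 0 α
    rw [zero_add] at h1
    rw [h1]
    have h2 := intervalIntegral.integral_comp_add_right (a := 0) (b := 1)
      (fun x => φ x * Real.sin (2 * Real.pi * n * (x - α))) α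
    simp only [add_sub_cancel_right, zero_add] at h2
    rw [h2, add_comm]
  have e1 : ∫ x in (0:ℝ)..1, (φ (x + α) - φ x + c) * Real.sin (2 * Real.pi * n * x)
      = (∫ x in (0:ℝ)..1, φ (x + α) * Real.sin (2 * Real.pi * n * x))
        - (∫ x in (0:ℝ)..1, φ x * Real.sin (2 * Real.pi * n * x))
        + c * ∫ x in (0:ℝ)..1, Real.sin (2 * Real.pi * n * x) := by
    rw [← intervalIntegral.integral_const_mul, ← intervalIntegral.integral_sub,
      ← intervalIntegral.integral_add]
    · refine intervalIntegral.integral_congr fun x _ => ?_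
      beta_reduce
      ring
    all_goals exact Continuous.intervalIntegrable (by fun_prop) _ _
  rw [e1, hs, hshift, ← intervalIntegral.integral_const_mul, ← intervalIntegral.integral_const_mul,
    ← intervalIntegral.integral_sub, ← intervalIntegral.integral_sub, mul_zero, add_zero]
  · refine intervalIntegral.integral_congr fun x _ => ?_
    beta_reduce
    rw [mul_sub, Real.sin_sub]
    ring
  all_goals exact Continuous.intervalIntegrable (by fun_prop) _ _

lemma dio_bounds (α : ℝ) (n : ℕ) (h : Dio α n) :
    |Real.cos (2 * Real.pi * n * α) - 1| ≤ 2 * Real.pi / n ∧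
    |Real.sin (2 * Real.pi * n * α)| ≤ 2 * Real.pi / n := by
  obtain ⟨hn, m, hm⟩ := h
  have e : 2 * Real.pi * n * α = 2 * Real.pi * (n * α - m) + m * (2 * Real.pi) := by ring
  have hb : |2 * Real.pi * (n * α - m)| ≤ 2 * Real.pi / n := by
    rw [abs_mul, abs_of_pos (by positivity)]
    calc _ ≤ 2 * Real.pi * (1 / n) := by gcongr
      _ = _ := by ring
  rw [e, Real.cos_add_int_mul_two_pi, Real.sin_add_int_mul_two_pi]
  constructor
  · have := Real.abs_cos_sub_cos_le (2 * Real.pi * (n * α - m)) 0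
    rw [Real.cos_zero, sub_zero] at this
    exact this.trans hb
  · have := Real.abs_sin_sub_sin_le (2 * Real.pi * (n * α - m)) 0
    rw [Real.sin_zero, sub_zero, sub_zero] at this
    exact this.trans hb

theorem stmt16 (α : ℝ) (hα : Irrational α)
    (hν : Filter.liminf
      (fun n : ℕ => (n : ℝ) * ‖((n * (2 * Real.pi * α) : ℝ) : AddCircle (1:ℝ))‖)
      Filter.atTop = 0)
    (l : ℤ) (hl : l ≠ 0) :
    ∃ f : ℝ → ℝ, Continuous f ∧ BoundedVariationOn f (Icc (0:ℝ) 1) ∧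
      (∀ x : ℝ, f (x + 1) - f x = l) ∧
      ¬ ∃ (φ : ℝ → ℝ) (c : ℝ), Continuous φ ∧ (∀ x : ℝ, φ (x + 1) = φ x) ∧
        ∀ x : ℝ, f x = φ (x + α) - φ x + l * x + c := by
  obtain ⟨F, hFc, hFm, hFd, hF⟩ := exists_F α hα
  refine ⟨fun x => l * F x, by fun_prop, ?_, fun x => by beta_reduce; rw [hFd]; ring, ?_⟩
  · have h1 : BoundedVariationOn F (Icc (0:ℝ) 1) := by
      apply (hFm.monotoneOn (Icc (0:ℝ) 1)).boundedVariationOn (C := |F 0| + |F 1|)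
      intro x hx
      have a := hFm hx.1
      have b := hFm hx.2
      rw [abs_le]
      constructor
      · linarith [neg_abs_le (F 0), abs_nonneg (F 1)]
      · linarith [le_abs_self (F 1), abs_nonneg (F 0)]
    have h2 : LipschitzWith ‖(l:ℝ)‖₊ (fun y : ℝ => (l:ℝ) * y) := lipschitzWith_smul (l:ℝ)
    exact h2.comp_boundedVariationOn h1
  · rintro ⟨φ, c, hφ, hper, h⟩
    have hlim := ((rl_sin φ hφ).abs.add (rl_cos φ hφ).abs).const_mul (2 * Real.pi)
    simp only [abs_zero, add_zero, mul_zero] at hlim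
    have hl1 : (1:ℝ) ≤ |(l:ℝ)| := by exact_mod_cast Int.one_le_abs hl
    obtain ⟨N, hN⟩ := eventually_atTop.1 (hlim.eventually (gt_mem_nhds (show (0:ℝ) < 1/100 by norm_num)))
    obtain ⟨n, hn, hD, hlow⟩ := hF N
    have hup := hN n hn
    have hn' : (0:ℝ) < n := by exact_mod_cast hD.1
    obtain ⟨hcb, hsb⟩ := dio_bounds α n hD
    have hpair := pairing α φ c hφ hper n hD.1
    have e : (l:ℝ) * ∫ x in (0:ℝ)..1, (F x - x) * Real.sin (2 * Real.pi * n * x) =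
        ∫ x in (0:ℝ)..1, (φ (x + α) - φ x + c) * Real.sin (2 * Real.pi * n * x) := by
      rw [← intervalIntegral.integral_const_mul]
      refine intervalIntegral.integral_congr fun x _ => ?_
      have := h x
      beta_reduce at this ⊢
      rw [← mul_assoc, mul_sub, this]
      ring
    rw [hpair] at e
    generalize (∫ x in (0:ℝ)..1, (F x - x) * Real.sin (2 * Real.pi * n * x)) = I at *
    generalize (∫ x in (0:ℝ)..1, φ x * Real.sin (2 * Real.pi * n * x)) = S at *
    generalize (∫ x in (0:ℝ)..1, φ x * Real.cos (2 * Real.pi * n * x)) = C at *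
    have h1 : |(l:ℝ) * I| ≤ 2 * Real.pi / n * |S| + 2 * Real.pi / n * |C| := by
      rw [e]
      refine (abs_sub _ _).trans ?_
      rw [abs_mul, abs_mul]
      gcongr
    have h2 : |I| ≤ |(l:ℝ) * I| := by
      rw [abs_mul]; nlinarith [abs_nonneg I]
    have h3 : (n:ℝ) * (2 * Real.pi / n * |S| + 2 * Real.pi / n * |C|) = 2 * Real.pi * (|S| + |C|) := by
      field_simp
    have h4 : (n:ℝ) * I ≤ 2 * Real.pi * (|S| + |C|) := by
      rw [← h3]
      gcongr
      exact (le_abs_self I).trans (h2.trans h1)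
    linarith
end
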